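/- Let 1 ≤ p ≤ ∞ and let (z_i)_{i=1}^n be a normalized basic sequence in a Banach space with basis constant at most M. Suppose there exists k with 1 ≤ k ≤ n such that (z_i)_{i=1}^k is 2-equivalent to the unit vector basis of ℓ_p^k and (z_i)_{i=k+1}^n is 2-equivalent to the unit vector basis of ℓ_p^{n-k} (with c_0^m in place of ℓ_p^m when p = ∞). Then (z_i)_{i=1}^n is 16(M+1)-equivalent to the unit vector basis of ℓ_p^n. -/

import Mathlib

open scoped ENNReal
open Filter Topology

/-- The `ℓ_p` norm of a finite real sequence, `(∑ |a i|^p)^(1/p)` for `p < ∞`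
and `max |a i|` for `p = ∞`. -/
noncomputable def lpNorm (p : ℝ≥0∞) {n : ℕ} (a : Fin n → ℝ) : ℝ :=
  if p = ∞ then ⨆ i, |a i| else (∑ i, |a i| ^ p.toReal) ^ (1 / p.toReal)

/-- `(y i)_{i<n}` is `C`-equivalent to the unit vector basis of `ℓ_p^n`
(of `c_0^n`, i.e. `ℓ_∞^n`, when `p = ∞`). -/
def FinLpEquiv {X : Type*} [NormedAddCommGroup X] [NormedSpace ℝ X] (C : ℝ) (p : ℝ≥0∞) {n : ℕ}
    (y : Fin n → X) : Prop :=
  ∀ a : Fin n → ℝ,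
    C⁻¹ * lpNorm p a ≤ ‖∑ i, a i • y i‖ ∧ ‖∑ i, a i • y i‖ ≤ C * lpNorm p a

theorem lpNorm_comp_le {p : ℝ≥0∞} {m n : ℕ} {f : Fin m → Fin n} (hf : Function.Injective f)
    (a : Fin n → ℝ) : lpNorm p (a ∘ f) ≤ lpNorm p a := by
  unfold lpNorm
  split_ifs with h
  · refine Real.iSup_le (fun i => ?_) (Real.iSup_nonneg fun i => abs_nonneg _)
    exact le_ciSup (f := fun i => |a i|) (Set.finite_range _).bddAbove (f i)
  · have hnn : ∀ i, 0 ≤ |a i| ^ p.toReal := fun i => by positivity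
    refine Real.rpow_le_rpow (Finset.sum_nonneg fun i _ => hnn (f i)) ?_ (by positivity)
    calc ∑ i, |a (f i)| ^ p.toReal
        = ∑ i ∈ Finset.univ.map ⟨f, hf⟩, |a i| ^ p.toReal := by rw [Finset.sum_map]; rfl
      _ ≤ ∑ i, |a i| ^ p.toReal :=
        Finset.sum_le_sum_of_subset_of_nonneg (Finset.subset_univ _) fun i _ _ => hnn i

theorem lpNorm_nonneg (p : ℝ≥0∞) {n : ℕ} (a : Fin n → ℝ) : 0 ≤ lpNorm p a := by
  unfold lpNorm
  split_ifs
  · exact Real.iSup_nonneg fun i => abs_nonneg _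
  · positivity

theorem lpNorm_le_add_of_equiv_sum {p : ℝ≥0∞} (hp : 1 ≤ p) {l m n : ℕ}
    (e : Fin l ⊕ Fin m ≃ Fin n) (a : Fin n → ℝ) :
    lpNorm p a ≤ lpNorm p (a ∘ e ∘ Sum.inl) + lpNorm p (a ∘ e ∘ Sum.inr) := by
  have hl := lpNorm_nonneg p (a ∘ e ∘ Sum.inl)
  have hr := lpNorm_nonneg p (a ∘ e ∘ Sum.inr)
  unfold lpNorm at *
  split_ifs at * with h
  · refine Real.iSup_le (fun i => ?_) (add_nonneg hl hr)
    obtain ⟨j | j, rfl⟩ := e.surjective i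
    · have := le_ciSup (f := fun i => |(a ∘ e ∘ Sum.inl) i|) (Set.finite_range _).bddAbove j
      exact this.trans (le_add_of_nonneg_right hr)
    · have := le_ciSup (f := fun i => |(a ∘ e ∘ Sum.inr) i|) (Set.finite_range _).bddAbove j
      exact this.trans (le_add_of_nonneg_left hl)
  · have hp' : 1 ≤ p.toReal := by
      simpa using (ENNReal.toReal_le_toReal ENNReal.one_ne_top h).2 hp
    rw [← e.sum_comp, Fintype.sum_sum_type]
    exact Real.rpow_add_le_add_rpow (by positivity) (by positivity) (by positivity)
      ((div_le_one (by linarith)).2 hp')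

/-- If a normalized finite basic sequence `(z i)_{i<n}` with basis constant at most `M`
splits as a prefix of length `k` that is `2`-equivalent to the unit vector basis of
`ℓ_p^k` and a suffix `2`-equivalent to the unit vector basis of `ℓ_p^{n-k}` (with `c_0^m`
in place of `ℓ_p^m` when `p = ∞`), then the whole sequence is `16(M+1)`-equivalent to the
unit vector basis of `ℓ_p^n`. -/
theorem finLpEquiv_of_prefix_suffix {X : Type*} [NormedAddCommGroup X] [NormedSpace ℝ X]
    [CompleteSpace X] (p : ℝ≥0∞) (hp : 1 ≤ p) (n : ℕ) (z : Fin n → X) (M : ℝ)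
    (hnorm : ∀ i, ‖z i‖ = 1)
    (hbasis : ∀ (a : Fin n → ℝ) (m : ℕ), m ≤ n →
      ‖∑ i ∈ Finset.univ.filter (fun i : Fin n => i.val < m), a i • z i‖ ≤
        M * ‖∑ i, a i • z i‖)
    (k : ℕ) (hk1 : 1 ≤ k) (hkn : k ≤ n)
    (hpre : FinLpEquiv 2 p (fun i : Fin k => z (Fin.castLE hkn i)))
    (hsuf : FinLpEquiv 2 p (fun i : Fin (n - k) => z ⟨k + i.val, by
      have := i.isLt; omega⟩)) :
    FinLpEquiv (16 * (M + 1)) p z := by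
  have hM : 1 ≤ M := by
    have h := hbasis (Pi.single ⟨0, by omega⟩ 1) n le_rfl
    simpa [Pi.single_apply, ite_smul, hnorm] using h
  let e : Fin k ⊕ Fin (n - k) ≃ Fin n :=
    finSumFinEquiv.trans (finCongr (Nat.add_sub_cancel' hkn))
  intro a
  obtain ⟨hpre_lower, hpre_upper⟩ := hpre (a ∘ e ∘ Sum.inl)
  obtain ⟨hsuf_lower, hsuf_upper⟩ := hsuf (a ∘ e ∘ Sum.inr)
  set u := ∑ i, (a ∘ e ∘ Sum.inl) i • z (Fin.castLE hkn i) with hu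
  set v := ∑ i : Fin (n - k), (a ∘ e ∘ Sum.inr) i • z ⟨k + i.val, by
    have := i.isLt; omega⟩
  have hsum : ∑ i, a i • z i = u + v := by
    rw [← e.sum_comp, Fintype.sum_sum_type]
    rfl
  have hproj : ∑ i ∈ Finset.univ.filter (fun i : Fin n => i.val < k), a i • z i = u := by
    rw [Finset.sum_filter, ← e.sum_comp, Fintype.sum_sum_type]
    simp [e, hu]
    rfl
  have hu_le := hbasis a k hkn
  rw [hproj, hsum] at hu_le
  have hv_le : ‖v‖ ≤ ‖u + v‖ + ‖u‖ := by simpa using norm_sub_le (u + v) u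
  have huv := norm_add_le u v
  have hadd := lpNorm_le_add_of_equiv_sum hp e a
  have hl := lpNorm_comp_le (p := p) (e.injective.comp Sum.inl_injective) a
  have hr := lpNorm_comp_le (p := p) (e.injective.comp Sum.inr_injective) a
  have hnn := lpNorm_nonneg p a
  have hnuv := norm_nonneg (u + v)
  rw [hsum]
  constructor
  · rw [inv_mul_le_iff₀ (by linarith)]
    nlinarith
  · nlinarith
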